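/- Let T = k[x₁^{±1},...,x_m^{±1}] be a Poisson torus with bracket {x_i,x_j} = p_{ij} x_i x_j (p_{ij} ∈ k), and suppose T is Poisson simple (has no nonzero proper Poisson ideals). Then for every 0-valuation ν on the Poisson fraction field K = Q(T), the Poisson fraction field of the associated graded algebra gr_ν(K) is isomorphic to K. Moreover, 0-valuations on K are in bijection with Z^m via ν ↦ (ν(x₁),...,ν(x_m)). -/

import Mathlib

set_option synthInstance.maxHeartbeats 1000000
set_option maxHeartbeats 1000000

/-- A Poisson bracket on a commutative algebra `A` over `k`. -/
structure PoissonBracket (k A : Type*) [CommRing k] [CommRing A] [Algebra k A] where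
  bracket : A → A → A
  add_left : ∀ a b c : A, bracket (a + b) c = bracket a c + bracket b c
  smul_left : ∀ (r : k) (a b : A), bracket (r • a) b = r • bracket a b
  antisymm : ∀ a b : A, bracket a b = - bracket b a
  leibniz : ∀ a b c : A, bracket a (b * c) = bracket a b * c + bracket a c * b
  jacobi : ∀ a b c : A,
    bracket a (bracket b c) + bracket b (bracket c a) + bracket c (bracket a b) = 0

/-- A discrete valuation on a field `K` over `k`. -/
def IsValuationOn (k K : Type*) [Field k] [Field K] [Algebra k K]
    (ν : K → WithTop ℤ) : Prop :=
  (∀ a : K, ν a = ⊤ ↔ a = 0) ∧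
  (∀ c : k, c ≠ 0 → ν (algebraMap k K c) = 0) ∧
  (∀ a b : K, ν (a * b) = ν a + ν b) ∧
  (∀ a b : K, min (ν a) (ν b) ≤ ν (a + b))

/-- The filtration of `K` attached to a valuation `ν`:
`F i = {a ∈ K : ν a ≥ i}`. -/
def valFilt {K : Type*} [Field K] (ν : K → WithTop ℤ) (i : ℤ) : Set K :=
  {a : K | (i : WithTop ℤ) ≤ ν a}

namespace Stmt16Aux

section
variable {k K M : Type*} [Field k] [Field K] [Algebra k K] [AddCommGroup M]

lemma lift_eq {A : Type*} [CommRing A] [Algebra k A] (Y : Multiplicative M →* A)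
    (f : AddMonoidAlgebra k M) :
    AddMonoidAlgebra.lift k A M Y f =
      Finsupp.linearCombination k (fun u : M => Y (Multiplicative.ofAdd u)) f.coeff := by
  rw [AddMonoidAlgebra.lift_apply]; rfl

lemma lift_inj {A : Type*} [CommRing A] [Algebra k A] (Y : Multiplicative M →* A)
    (hY : LinearIndependent k (fun u : M => Y (Multiplicative.ofAdd u))) :
    Function.Injective (AddMonoidAlgebra.lift k A M Y) := by
  intro f g h
  rw [lift_eq, lift_eq] at h
  have := hY h
  cases f; cases g; simpa using this

lemma lift_surj {A : Type*} [CommRing A] [Algebra k A] (Y : Multiplicative M →* A) (t : A)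
    (ht : t ∈ Submodule.span k (Set.range (fun u : M => Y (Multiplicative.ofAdd u)))) :
    ∃ f, AddMonoidAlgebra.lift k A M Y f = t := by
  rw [← Finsupp.range_linearCombination] at ht
  obtain ⟨f, hf⟩ := ht
  exact ⟨AddMonoidAlgebra.ofCoeff f, by rw [lift_eq]; exact hf⟩

lemma ext_hom (X : Multiplicative M →* K)
    (hX : LinearIndependent k (fun u : M => X (Multiplicative.ofAdd u)))
    (hfrac : ∀ q : K,
      ∃ a ∈ Submodule.span k (Set.range (fun u : M => X (Multiplicative.ofAdd u))),
      ∃ b ∈ Submodule.span k (Set.range (fun u : M => X (Multiplicative.ofAdd u))),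
        b ≠ 0 ∧ q = a / b)
    {L : Type*} [Field L] [Algebra k L] (Y : Multiplicative M →* L)
    (hY : LinearIndependent k (fun u : M => Y (Multiplicative.ofAdd u))) :
    ∃ e : K →ₐ[k] L, ∀ u : M, e (X (Multiplicative.ofAdd u)) = Y (Multiplicative.ofAdd u) := by
  classical
  let θ := AddMonoidAlgebra.lift k K M X
  have hθ : Function.Injective θ := lift_inj X hX
  have : IsDomain (AddMonoidAlgebra k M) := hθ.isDomain θ
  let _ : Algebra (AddMonoidAlgebra k M) K := θ.toRingHom.toAlgebra
  have : IsScalarTower k (AddMonoidAlgebra k M) K := IsScalarTower.of_algebraMap_eq fun c => by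
    exact (θ.commutes c).symm
  have : FaithfulSMul (AddMonoidAlgebra k M) K :=
    (faithfulSMul_iff_algebraMap_injective _ _).2 hθ
  have : IsFractionRing (AddMonoidAlgebra k M) K := by
    refine IsFractionRing.of_field _ _ fun z => ?_
    obtain ⟨a, ha, b, hb, -, rfl⟩ := hfrac z
    obtain ⟨f, rfl⟩ := lift_surj X a ha
    obtain ⟨g, rfl⟩ := lift_surj X b hb
    exact ⟨f, g, rfl⟩
  have hi : Function.Injective (AddMonoidAlgebra.lift k L M Y) := lift_inj Y hY
  refine ⟨IsFractionRing.liftAlgHom (K := K) hi, fun u => ?_⟩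
  have h1 : X (Multiplicative.ofAdd u) =
    algebraMap (AddMonoidAlgebra k M) K (AddMonoidAlgebra.single u 1) := by
    change _ = θ _
    simp [θ]
  rw [h1, IsFractionRing.liftAlgHom_apply, IsFractionRing.lift_algebraMap]
  simp

lemma aug_ne {A : Type*} [CommRing A] [Algebra k A] (X : Multiplicative M →* A)
    (hX : LinearIndependent k (fun u : M => X (Multiplicative.ofAdd u))) (v : M) (s : A)
    (hs : s ∈ Submodule.span k (Set.range (fun u : M => X (Multiplicative.ofAdd u)))) :
    s * (X (Multiplicative.ofAdd v) - 1) ≠ 1 := by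
  intro h
  obtain ⟨f, rfl⟩ := lift_surj X s hs
  have h2 : f * (AddMonoidAlgebra.single v 1 - 1) = 1 := by
    apply lift_inj X hX
    rw [map_mul, map_sub, map_one, AddMonoidAlgebra.lift_single, one_smul, h]
  have h3 := congrArg (AddMonoidAlgebra.lift k k M 1) h2
  rw [map_mul, map_sub, AddMonoidAlgebra.lift_single,
    map_one (AddMonoidAlgebra.lift k k M 1)] at h3
  simp at h3

end

section bracket
variable {k K : Type*} [CommRing k] [CommRing K] [Algebra k K] (PB : PoissonBracket k K)
include PB

lemma add_right (a b c : K) : PB.bracket a (b + c) = PB.bracket a b + PB.bracket a c := by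
  rw [PB.antisymm, PB.add_left, PB.antisymm b, PB.antisymm c]; ring

lemma smul_right (r : k) (a b : K) : PB.bracket a (r • b) = r • PB.bracket a b := by
  rw [PB.antisymm, PB.smul_left, PB.antisymm b, smul_neg, neg_neg]

/-- bracket as a linear map in the second argument -/
def adL (a : K) : K →ₗ[k] K where
  toFun := PB.bracket a
  map_add' := add_right PB a
  map_smul' r b := smul_right PB r a b

@[simp] lemma adL_apply (a b : K) : adL PB a b = PB.bracket a b := rfl

lemma one_right (a : K) : PB.bracket a 1 = 0 := by
  have := PB.leibniz a 1 1
  simpa using this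

lemma span_induct (S : Set K) (p : K → K → Prop)
    (hp : ∀ a ∈ S, ∀ b ∈ S, p a b)
    (h0 : ∀ a, p a 0) (hadd : ∀ a b c, p a b → p a c → p a (b + c))
    (hsm : ∀ (r : k) a b, p a b → p a (r • b))
    (hsymm : ∀ a b, p a b → p b a) :
    ∀ a ∈ Submodule.span k S, ∀ b ∈ Submodule.span k S, p a b := by
  have h1 : ∀ a ∈ S, ∀ b ∈ Submodule.span k S, p a b := by
    intro a ha b hb
    induction hb using Submodule.span_induction with
    | mem x h => exact hp a ha x h
    | zero => exact h0 a
    | add x y _ _ hx hy => exact hadd _ _ _ hx hy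
    | smul r x _ hx => exact hsm _ _ _ hx
  intro a ha b hb
  induction hb using Submodule.span_induction with
  | mem x h => exact hsymm _ _ (h1 x h a ha)
  | zero => exact h0 a
  | add x y _ _ hx hy => exact hadd _ _ _ hx hy
  | smul r x _ hx => exact hsm _ _ _ hx

end bracket

section frac
variable {k K : Type*} [Field k] [Field K] [Algebra k K]

lemma frac_induct (S : Set K) (hfrac : ∀ q : K, ∃ a ∈ S, ∃ b ∈ S, b ≠ 0 ∧ q = a / b)
    (p : K → K → Prop) (hp : ∀ a ∈ S, ∀ b ∈ S, p a b)
    (hdiv : ∀ a b c, c ≠ 0 → p a b → p a c → p a (b / c))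
    (hsymm : ∀ a b, p a b → p b a) (a b : K) : p a b := by
  obtain ⟨a, ha, a', ha', h0, rfl⟩ := hfrac a
  obtain ⟨b, hb, b', hb', h0', rfl⟩ := hfrac b
  have h1 : ∀ a ∈ S, p a (b / b') := fun a ha => hdiv _ _ _ h0' (hp _ ha _ hb) (hp _ ha _ hb')
  exact hsymm _ _ (hdiv _ _ _ h0 (hsymm _ _ (h1 _ ha)) (hsymm _ _ (h1 _ ha')))

lemma bracket_div (PB : PoissonBracket k K) (a b c : K) (hc : c ≠ 0) :
    PB.bracket a (b / c) * c = PB.bracket a b - PB.bracket a c * (b / c) := by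
  have := PB.leibniz a (b / c) c
  rw [div_mul_cancel₀ _ hc] at this
  rw [this]; ring

lemma poisson_hom (PB : PoissonBracket k K) {L : Type*} [Field L] [Algebra k L]
    (PL : PoissonBracket k L) (e : K →ₐ[k] L) (S : Set K)
    (hfrac : ∀ q : K, ∃ a ∈ Submodule.span k S, ∃ b ∈ Submodule.span k S, b ≠ 0 ∧ q = a / b)
    (hS : ∀ a ∈ S, ∀ b ∈ S, e (PB.bracket a b) = PL.bracket (e a) (e b)) (a b : K) :
    e (PB.bracket a b) = PL.bracket (e a) (e b) := by
  have hs : ∀ a b, e (PB.bracket a b) = PL.bracket (e a) (e b) →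
      e (PB.bracket b a) = PL.bracket (e b) (e a) := by
    intro a b h
    rw [PB.antisymm, PL.antisymm, map_neg, h]
  refine frac_induct (Submodule.span k S : Set K) hfrac
    (fun a b => e (PB.bracket a b) = PL.bracket (e a) (e b)) ?_ ?_ hs a b
  · refine span_induct PB S _ hS ?_ ?_ ?_ hs
    · intro a
      have h1 := (adL PB a).map_zero
      have h2 := (adL PL (e a)).map_zero
      simp only [adL_apply] at h1 h2
      simp [h1, h2]
    · intro a b c h h'
      simp only [add_right, map_add, h, h']
    · intro r a b h
      simp only [smul_right, map_smul, h]
  · intro a b c hc h h'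
    have hc' : e c ≠ 0 := by simpa using hc
    apply mul_right_cancel₀ hc'
    rw [map_div₀, bracket_div PL _ _ _ hc', ← map_mul, bracket_div PB _ _ _ hc, map_sub, map_mul,
      map_div₀, h, h']

end frac

section val
variable {k K : Type*} [Field k] [Field K] [Algebra k K] {ν : K → WithTop ℤ}
  (hν : IsValuationOn k K ν)
include hν

lemma v_zero : ν 0 = ⊤ := (hν.1 0).2 rfl

lemma v_smul (c : k) (a : K) (hc : c ≠ 0) : ν (c • a) = ν a := by
  rw [Algebra.smul_def, hν.2.2.1, hν.2.1 c hc, zero_add]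

lemma v_smul_le (c : k) (a : K) : ν a ≤ ν (c • a) := by
  by_cases hc : c = 0
  · simp [hc, v_zero hν]
  · rw [v_smul hν c a hc]

lemma v_one : ν 1 = 0 := by simpa using hν.2.1 1 one_ne_zero

lemma v_neg (a : K) : ν (-a) = ν a := by
  simpa using v_smul hν (-1) a (by simp)

lemma v_sub {n : WithTop ℤ} {a b : K} (ha : n ≤ ν a) (hb : n ≤ ν b) : n ≤ ν (a - b) := by
  rw [sub_eq_add_neg]
  exact (le_min ha (by rwa [v_neg hν])).trans (hν.2.2.2 _ _)

lemma v_add {n : WithTop ℤ} {a b : K} (ha : n ≤ ν a) (hb : n ≤ ν b) : n ≤ ν (a + b) :=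
  (le_min ha hb).trans (hν.2.2.2 _ _)

lemma v_sum {ι : Type*} (s : Finset ι) (f : ι → K) {n : WithTop ℤ} (h : ∀ i ∈ s, n ≤ ν (f i)) :
    n ≤ ν (∑ i ∈ s, f i) := by
  classical
  induction s using Finset.induction_on with
  | empty => simp [v_zero hν]
  | insert i s hi ih =>
    rw [Finset.sum_insert hi]
    exact v_add hν (h _ (by simp)) (ih fun j hj => h j (by simp [hj]))

lemma v_mul (a b : K) : ν (a * b) = ν a + ν b := hν.2.2.1 a b

lemma v_ne_top {a : K} (ha : a ≠ 0) : ν a ≠ ⊤ := fun h => ha ((hν.1 a).1 h)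

lemma zero_val_div (PB : PoissonBracket k K) (a b c : K) (hc : c ≠ 0)
    (h : ν a + ν b ≤ ν (PB.bracket a b)) (h' : ν a + ν c ≤ ν (PB.bracket a c)) :
    ν a + ν (b / c) ≤ ν (PB.bracket a (b / c)) := by
  have h1 : ν (b / c) + ν c = ν b := by rw [← v_mul hν, div_mul_cancel₀ _ hc]
  have h2 : (ν a + ν (b / c)) + ν c ≤ ν (PB.bracket a (b / c)) + ν c := by
    rw [← v_mul hν (PB.bracket a (b / c)), bracket_div PB _ _ _ hc, add_assoc, h1]
    refine v_sub hν h ?_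
    rw [v_mul hν, ← h1, add_comm (ν (b / c)), ← add_assoc]
    gcongr
  exact (WithTop.add_le_add_iff_right (v_ne_top hν hc)).1 h2

variable {M : Type*} (PB : PoissonBracket k K)
    (h0 : ∀ a b : K, ν a + ν b ≤ ν (PB.bracket a b))
    (X : M → K) (hX0 : ∀ u, X u ≠ 0) (lam : M → M → k)
    (hlam : ∀ w u, PB.bracket (X w) (X u) = lam w u • (X w * X u))
    (hnd : ∀ u u', u ≠ u' → ∃ w, lam w u ≠ lam w u')
include h0 hX0 hlam hnd

lemma val_key : ∀ (n : ℕ) (s : Finset M) (_ : s.card = n) (c : M → k) (u : M), u ∈ s → c u ≠ 0 →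
    ν (∑ i ∈ s, c i • X i) ≤ ν (X u) := by
  classical
  intro n
  induction n with
  | zero => intro s hs c u hu; simp at hs; simp [hs] at hu
  | succ n ih =>
    intro s hs c u hu hc
    by_cases hex : ∃ u' ∈ s, u' ≠ u
    · obtain ⟨u', hu', hne⟩ := hex
      obtain ⟨w, hw⟩ := hnd u u' hne.symm
      refine le_trans ?_ (ih (s.erase u') (by rw [Finset.card_erase_of_mem hu', hs]; rfl)
        (fun i => (lam w i - lam w u') * c i) u (by simp [hu, hne.symm])
        (mul_ne_zero (sub_ne_zero.2 hw) hc))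
      set t := ∑ i ∈ s, c i • X i with ht
      have h1 : PB.bracket (X w) t = X w * ∑ i ∈ s, (lam w i * c i) • X i := by
        rw [← adL_apply, ht, map_sum, Finset.mul_sum]
        refine Finset.sum_congr rfl fun i _ => ?_
        rw [map_smul, adL_apply, hlam, mul_smul_comm, smul_smul, mul_comm]
      have h2 : ∑ i ∈ s.erase u', ((lam w i - lam w u') * c i) • X i =
          (∑ i ∈ s, (lam w i * c i) • X i) - lam w u' • t := by
        rw [Finset.sum_erase _ (by simp), ht, Finset.smul_sum, ← Finset.sum_sub_distrib]
        refine Finset.sum_congr rfl fun i _ => ?_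
        rw [smul_smul, ← sub_smul, sub_mul]
      rw [h2]
      refine v_sub hν ?_ (v_smul_le hν _ _)
      have h3 := h0 (X w) t
      rw [h1, v_mul hν] at h3
      exact (WithTop.add_le_add_iff_left (v_ne_top hν (hX0 w))).1 h3
    · push Not at hex
      have : s = {u} := by
        ext i; constructor
        · intro h; simpa using hex i h
        · intro h; simp at h; simpa [h] using hu
      rw [this]; simp [v_smul hν _ _ hc]

lemma val_key' (s : Finset M) (c : M → k) (n : WithTop ℤ) :
    n ≤ ν (∑ i ∈ s, c i • X i) ↔ ∀ i ∈ s, c i ≠ 0 → n ≤ ν (X i) := by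
  constructor
  · intro h i hi hc
    exact h.trans (val_key hν PB h0 X hX0 lam hlam hnd _ s rfl c i hi hc)
  · intro h
    refine v_sum hν _ _ fun i hi => ?_
    by_cases hc : c i = 0
    · simp [hc, v_zero hν]
    · exact (h i hi hc).trans (v_smul_le hν _ _)

end val

section exist
variable {k K M : Type*} [Field k] [Field K] [Algebra k K] [AddCommGroup M]

noncomputable instance (priority := 2000) hahnAlg : Algebra k (HahnSeries ℤ K) :=
  HahnSeries.instAlgebra

lemma hahn_coeff (X : M → K) (hX : LinearIndependent k X) (deg : M → ℤ)
    (s : Finset M) (c : M → k) (j : M) (hj : j ∈ s)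
    (h : (∑ i ∈ s, c i • (HahnSeries.single (deg i) (X i) : HahnSeries ℤ K)).coeff (deg j) = 0) :
    c j = 0 := by
  classical
  rw [HahnSeries.coeff_sum] at h
  have h2 : ∑ i ∈ s with deg i = deg j, c i • X i = 0 := by
    rw [Finset.sum_filter]
    refine Eq.trans ?_ h
    refine Finset.sum_congr rfl fun i _ => ?_
    rw [HahnSeries.coeff_smul, HahnSeries.coeff_single]
    by_cases hd : deg i = deg j
    · simp [hd]
    · simp [hd, Ne.symm hd]
  exact linearIndependent_iff'.1 hX _ c h2 j (by simp [hj])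

lemma val_exists (PB : PoissonBracket k K) (X : Multiplicative M →* K)
    (hX : LinearIndependent k (fun u : M => X (Multiplicative.ofAdd u)))
    (hfrac : ∀ q : K,
      ∃ a ∈ Submodule.span k (Set.range (fun u : M => X (Multiplicative.ofAdd u))),
      ∃ b ∈ Submodule.span k (Set.range (fun u : M => X (Multiplicative.ofAdd u))),
        b ≠ 0 ∧ q = a / b)
    (lam : M → M → k)
    (hlam : ∀ w u : M, PB.bracket (X (Multiplicative.ofAdd w)) (X (Multiplicative.ofAdd u)) =
      lam w u • (X (Multiplicative.ofAdd w) * X (Multiplicative.ofAdd u)))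
    (deg : M →+ ℤ) :
    ∃ ν : K → WithTop ℤ, IsValuationOn k K ν ∧ (∀ a b : K, ν a + ν b ≤ ν (PB.bracket a b)) ∧
      ∀ u : M, ν (X (Multiplicative.ofAdd u)) = (deg u : WithTop ℤ) := by
  classical
  let Y : Multiplicative M →* HahnSeries ℤ K :=
    { toFun := fun u => HahnSeries.single (deg (Multiplicative.toAdd u)) (X u)
      map_one' := by simp
      map_mul' := fun u w => by simp [HahnSeries.single_mul_single] }
  have hYd : ∀ u : M, Y (Multiplicative.ofAdd u) =
      HahnSeries.single (deg u) (X (Multiplicative.ofAdd u)) := fun u => rfl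
  have hXne : ∀ u : M, X (Multiplicative.ofAdd u) ≠ 0 := fun u => hX.ne_zero u
  have hY : LinearIndependent k (fun u : M => Y (Multiplicative.ofAdd u)) := by
    rw [linearIndependent_iff']
    intro s c h j hj
    refine hahn_coeff _ hX deg s c j hj ?_
    simp only [hYd] at h
    rw [h]; simp
  obtain ⟨e, he⟩ := ext_hom X hX hfrac Y hY
  have hval : IsValuationOn k K (fun a => (e a).orderTop) := by
    refine ⟨fun a => by simp, fun c hc => ?_, fun a b => ?_, fun a b => ?_⟩
    · change (e _).orderTop = 0
      rw [AlgHom.commutes, HahnSeries.algebraMap_apply, HahnSeries.C_apply,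
        HahnSeries.orderTop_single (by simpa using hc)]
      rfl
    · simp only [map_mul]; exact HahnSeries.orderTop_mul _ _
    · simp only [map_add]; exact HahnSeries.min_orderTop_le_orderTop_add
  have hdeg : ∀ u : M, (e (X (Multiplicative.ofAdd u))).orderTop = (deg u : WithTop ℤ) := by
    intro u
    rw [he, hYd, HahnSeries.orderTop_single (hXne u)]
  have hkey : ∀ (s : Finset M) (c : M → k) (j : M), j ∈ s → c j ≠ 0 →
      (e (∑ i ∈ s, c i • X (Multiplicative.ofAdd i))).orderTop ≤ (deg j : WithTop ℤ) := by
    intro s c j hj hc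
    refine HahnSeries.orderTop_le_of_coeff_ne_zero fun h => hc ?_
    refine hahn_coeff _ hX deg s c j hj ?_
    rw [← h]
    simp only [map_sum, map_smul, he, hYd]
  refine ⟨fun a => (e a).orderTop, hval, ?_, hdeg⟩
  refine frac_induct _ hfrac
    (fun a b => (e a).orderTop + (e b).orderTop ≤ (e (PB.bracket a b)).orderTop) ?_ ?_ ?_
  · intro a ha b hb
    obtain ⟨f, rfl⟩ := Finsupp.mem_span_range_iff_exists_finsupp.1 ha
    obtain ⟨g, rfl⟩ := Finsupp.mem_span_range_iff_exists_finsupp.1 hb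
    simp only [Finsupp.sum]
    set A := ∑ i ∈ f.support, f i • X (Multiplicative.ofAdd i) with hA
    set B := ∑ i ∈ g.support, g i • X (Multiplicative.ofAdd i) with hB
    have h1 : PB.bracket A B = ∑ j ∈ g.support, ∑ i ∈ f.support,
        (-(g j * f i * lam j i)) • (X (Multiplicative.ofAdd j) * X (Multiplicative.ofAdd i)) := by
      rw [← adL_apply, hB, map_sum]
      refine Finset.sum_congr rfl fun j _ => ?_
      rw [map_smul, adL_apply, PB.antisymm, ← adL_apply, hA, map_sum, ← Finset.sum_neg_distrib,
        Finset.smul_sum]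
      refine Finset.sum_congr rfl fun i _ => ?_
      rw [map_smul, adL_apply, hlam, smul_neg, smul_smul, smul_smul, neg_smul]
    rw [h1]
    refine v_sum hval _ _ fun j hj => v_sum hval _ _ fun i hi => ?_
    refine le_trans ?_ (v_smul_le hval _ _)
    simp only [map_mul]
    rw [HahnSeries.orderTop_mul, hdeg, hdeg, add_comm]
    exact add_le_add (hkey _ _ _ hj (by simpa using hj)) (hkey _ _ _ hi (by simpa using hi))
  · intro a b c hc h h'
    exact zero_val_div hval PB a b c hc h h'
  · intro a b h
    rw [PB.antisymm, map_neg, HahnSeries.orderTop_neg, add_comm]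
    exact h

end exist

section unique
variable {k K M : Type*} [Field k] [Field K] [Algebra k K]

lemma val_unique (PB : PoissonBracket k K) (X : M → K) (hX0 : ∀ u, X u ≠ 0)
    (hfrac : ∀ q : K, ∃ a ∈ Submodule.span k (Set.range X),
      ∃ b ∈ Submodule.span k (Set.range X), b ≠ 0 ∧ q = a / b)
    (lam : M → M → k)
    (hlam : ∀ w u : M, PB.bracket (X w) (X u) = lam w u • (X w * X u))
    (hnd : ∀ u u', u ≠ u' → ∃ w, lam w u ≠ lam w u')
    (ν μ : K → WithTop ℤ) (hν : IsValuationOn k K ν) (hμ : IsValuationOn k K μ)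
    (h0 : ∀ a b : K, ν a + ν b ≤ ν (PB.bracket a b))
    (h0' : ∀ a b : K, μ a + μ b ≤ μ (PB.bracket a b))
    (heq : ∀ u, ν (X u) = μ (X u)) : ν = μ := by
  have hT : ∀ t ∈ Submodule.span k (Set.range X), ν t = μ t := by
    intro t ht
    obtain ⟨f, rfl⟩ := Finsupp.mem_span_range_iff_exists_finsupp.1 ht
    simp only [Finsupp.sum]
    refine eq_of_forall_le_iff fun n => ?_
    rw [val_key' hν PB h0 X hX0 lam hlam hnd, val_key' hμ PB h0' X hX0 lam hlam hnd]
    simp only [heq]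
  funext q
  obtain ⟨a, ha, b, hb, hb0, rfl⟩ := hfrac q
  have h1 : ν (a / b) + ν b = ν a := by rw [← v_mul hν, div_mul_cancel₀ _ hb0]
  have h2 : μ (a / b) + μ b = μ a := by rw [← v_mul hμ, div_mul_cancel₀ _ hb0]
  rw [hT a ha, hT b hb, ← h2] at h1
  exact (WithTop.add_right_inj (v_ne_top hμ hb0)).1 h1

end unique

section gr
variable {k K M : Type*} [Field k] [Field K] [Algebra k K] [AddCommGroup M]

lemma gr_proj {G : Type*} [AddCommGroup G] [Module k G] (𝒢 : ℤ → Submodule k G)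
    (h : DirectSum.IsInternal 𝒢) (d : ℤ) :
    ∃ π : G →ₗ[k] G, (∀ g ∈ 𝒢 d, π g = g) ∧ ∀ i, i ≠ d → ∀ g ∈ 𝒢 i, π g = 0 := by
  let _ := h.chooseDecomposition
  refine ⟨(𝒢 d).subtype ∘ₗ DirectSum.component k ℤ (fun i => 𝒢 i) d ∘ₗ
    (DirectSum.decomposeLinearEquiv 𝒢).toLinearMap, ?_, ?_⟩
  · intro g hg
    simpa using! DirectSum.decompose_of_mem_same 𝒢 hg
  · intro i hi g hg
    simpa using! DirectSum.decompose_of_mem_ne 𝒢 hg hi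

lemma gr_iso (PB : PoissonBracket k K) (X : Multiplicative M →* K)
    (hX : LinearIndependent k (fun u : M => X (Multiplicative.ofAdd u)))
    (hfrac : ∀ q : K,
      ∃ a ∈ Submodule.span k (Set.range (fun u : M => X (Multiplicative.ofAdd u))),
      ∃ b ∈ Submodule.span k (Set.range (fun u : M => X (Multiplicative.ofAdd u))),
        b ≠ 0 ∧ q = a / b)
    (lam : M → M → k)
    (hlam : ∀ w u : M, PB.bracket (X (Multiplicative.ofAdd w)) (X (Multiplicative.ofAdd u)) =
      lam w u • (X (Multiplicative.ofAdd w) * X (Multiplicative.ofAdd u)))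
    (hnd : ∀ u u', u ≠ u' → ∃ w, lam w u ≠ lam w u')
    (ν : K → WithTop ℤ) (hν : IsValuationOn k K ν)
    (h0 : ∀ a b : K, ν a + ν b ≤ ν (PB.bracket a b))
    {G : Type*} [CommRing G] [Algebra k G] (PG : PoissonBracket k G)
    (𝒢 : ℤ → Submodule k G) (φ : ℤ → K → G)
    (hmem : ∀ i : ℤ, ∀ a ∈ valFilt ν i, φ i a ∈ 𝒢 i)
    (hadd : ∀ i : ℤ, ∀ a ∈ valFilt ν i, ∀ b ∈ valFilt ν i, φ i (a + b) = φ i a + φ i b)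
    (hsmul : ∀ (i : ℤ) (c : k), ∀ a ∈ valFilt ν i, φ i (c • a) = c • φ i a)
    (hker : ∀ i : ℤ, ∀ a ∈ valFilt ν i, (φ i a = 0 ↔ a ∈ valFilt ν (i + 1)))
    (hsurj : ∀ i : ℤ, ∀ g ∈ 𝒢 i, ∃ a ∈ valFilt ν i, φ i a = g)
    (hone : φ 0 1 = 1)
    (hmul : ∀ i j : ℤ, ∀ a ∈ valFilt ν i, ∀ b ∈ valFilt ν j, φ (i + j) (a * b) = φ i a * φ j b)
    (hint : DirectSum.IsInternal 𝒢)
    (hbr : ∀ i j : ℤ, ∀ a ∈ valFilt ν i, ∀ b ∈ valFilt ν j,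
      PG.bracket (φ i a) (φ j b) = φ (i + j) (PB.bracket a b))
    {L : Type*} [Field L] [Algebra k L] (PL : PoissonBracket k L) (ι : G →ₐ[k] L)
    (hι : Function.Injective ι)
    (hLfrac : ∀ q : L, ∃ a b : G, b ≠ 0 ∧ q * ι b = ι a)
    (hιbr : ∀ a b : G, ι (PG.bracket a b) = PL.bracket (ι a) (ι b)) :
    ∃ e : L ≃ₐ[k] K, ∀ a b : L, e (PL.bracket a b) = PB.bracket (e a) (e b) := by
  classical
  have hXne : ∀ u : M, X (Multiplicative.ofAdd u) ≠ 0 := fun u => hX.ne_zero u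
  have hdeg : ∀ u : M, ∃ d : ℤ, ν (X (Multiplicative.ofAdd u)) = (d : WithTop ℤ) := fun u =>
    ⟨_, (WithTop.coe_untop _ (v_ne_top hν (hXne u))).symm⟩
  choose deg hdeg using hdeg
  have hdeg0 : deg 0 = 0 := by
    have := hdeg 0
    rw [ofAdd_zero, map_one, v_one hν] at this
    exact_mod_cast this.symm
  have hdegadd : ∀ u w, deg (u + w) = deg u + deg w := by
    intro u w
    have := hdeg (u + w)
    rw [ofAdd_add, map_mul, v_mul hν, hdeg, hdeg] at this
    exact_mod_cast this.symm
  have hXF : ∀ u : M, X (Multiplicative.ofAdd u) ∈ valFilt ν (deg u) := fun u => (hdeg u).ge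
  have hzero : ∀ i, φ i 0 = 0 := by
    intro i
    have := hsmul i 0 0 (by simp [valFilt, v_zero hν])
    simpa using this
  have hsum : ∀ (i : ℤ) (s : Finset M) (f : M → K), (∀ j ∈ s, f j ∈ valFilt ν i) →
      φ i (∑ j ∈ s, f j) = ∑ j ∈ s, φ i (f j) := by
    intro i s f
    induction s using Finset.induction_on with
    | empty => intro _; simp [hzero]
    | insert a s ha ih =>
      intro h
      rw [Finset.sum_insert ha, Finset.sum_insert ha, hadd i _ (h _ (by simp)) _
        (v_sum hν _ _ fun j hj => h j (by simp [hj])), ih fun j hj => h j (by simp [hj])]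
  let Y0 : Multiplicative M →* G :=
    { toFun := fun u => φ (deg (Multiplicative.toAdd u)) (X u)
      map_one' := by simp [hdeg0, hone]
      map_mul' := fun u w => by
        rw [toAdd_mul, hdegadd, map_mul]
        exact hmul _ _ _ (hXF _) _ (hXF _) }
  have hY0d : ∀ u : M, Y0 (Multiplicative.ofAdd u) = φ (deg u) (X (Multiplicative.ofAdd u)) :=
    fun u => rfl
  have hY0 : LinearIndependent k (fun u : M => Y0 (Multiplicative.ofAdd u)) := by
    rw [linearIndependent_iff']
    intro s c h j hj
    obtain ⟨π, hπ1, hπ2⟩ := gr_proj 𝒢 hint (deg j)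
    have h1 := congrArg π h
    rw [map_sum, map_zero] at h1
    have h2 : φ (deg j) (∑ i ∈ s with deg i = deg j, c i • X (Multiplicative.ofAdd i)) = 0 := by
      rw [hsum, Finset.sum_filter]
      · refine Eq.trans (Finset.sum_congr rfl fun i _ => ?_) h1
        rw [map_smul, hY0d]
        split_ifs with hd
        · rw [hsmul _ _ _ (hd ▸ hXF i), ← hd, hπ1 _ (hd ▸ hmem _ _ (hXF i))]
        · rw [hπ2 _ hd _ (hmem _ _ (hXF i)), smul_zero]
      · intro i hi
        rw [Finset.mem_filter] at hi
        refine le_trans ?_ (v_smul_le hν _ _)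
        rw [← hi.2]; exact hXF i
    rw [hker] at h2
    · by_contra hc
      have h3 := (val_key' hν PB h0 _ hXne lam hlam hnd _ c _).1 h2 j (by simp [hj]) hc
      rw [hdeg] at h3
      have h4 : deg j + 1 ≤ deg j := by exact_mod_cast h3
      omega
    · refine v_sum hν _ _ fun i hi => ?_
      rw [Finset.mem_filter] at hi
      refine le_trans ?_ (v_smul_le hν _ _)
      rw [← hi.2]; exact hXF i
  let Y : Multiplicative M →* L := (ι : G →* L).comp Y0
  have hYd : ∀ u : M, Y (Multiplicative.ofAdd u) = ι (Y0 (Multiplicative.ofAdd u)) := fun u => rfl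
  have hY : LinearIndependent k (fun u : M => Y (Multiplicative.ofAdd u)) :=
    hY0.map' ι.toLinearMap (LinearMap.ker_eq_bot.2 hι)
  obtain ⟨e, he⟩ := ext_hom X hX hfrac Y hY
  have hmon : ∀ t ∈ Submodule.span k (Set.range (fun u : M => X (Multiplicative.ofAdd u))),
      ∀ d : ℤ, ν t = d → ι (φ d t) ∈ e.range := by
    intro t ht d hd
    obtain ⟨f, rfl⟩ := Finsupp.mem_span_range_iff_exists_finsupp.1 ht
    simp only [Finsupp.sum] at hd ⊢
    have h1 := (val_key' hν PB h0 _ hXne lam hlam hnd _ f _).1 hd.ge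
    rw [hsum, map_sum]
    · refine sum_mem fun i hi => ?_
      have h2 := h1 i hi (by simpa using hi)
      rw [hsmul _ _ _ h2, map_smul]
      refine Subalgebra.smul_mem _ ?_ _
      by_cases hdi : deg i = d
      · exact ⟨X (Multiplicative.ofAdd i), by
          rw [← hdi, ← hY0d, ← hYd]; exact he i⟩
      · have h3 : φ d (X (Multiplicative.ofAdd i)) = 0 := by
          rw [hker _ _ h2]
          rw [hdeg] at h2
          have h4 : d ≤ deg i := by exact_mod_cast h2
          have h5 : d + 1 ≤ deg i := by omega
          change ((d + 1 : ℤ) : WithTop ℤ) ≤ _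
          rw [hdeg]; exact_mod_cast h5
        rw [h3, map_zero]; exact zero_mem _
    · intro i hi
      exact (h1 i hi (by simpa using hi)).trans (v_smul_le hν _ _)
  have hdivmem : ∀ a b : L, a ∈ e.range → b ∈ e.range → a / b ∈ e.range := by
    rintro _ _ ⟨a, rfl⟩ ⟨b, rfl⟩
    exact ⟨a / b, map_div₀ e a b⟩
  have hG1 : ∀ i : ℤ, ∀ g ∈ 𝒢 i, ι g ∈ e.range := by
    intro i g hg
    obtain ⟨a, ha, rfl⟩ := hsurj i g hg
    by_cases hz : φ i a = 0
    · rw [hz, map_zero]; exact zero_mem _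
    have ha0 : a ≠ 0 := by rintro rfl; exact hz (hzero i)
    obtain ⟨s, hs, t, ht, ht0, hst⟩ := hfrac a
    have hs0 : s ≠ 0 := by rintro rfl; simp [hst] at ha0
    obtain ⟨n, hn⟩ := WithTop.ne_top_iff_exists.1 (v_ne_top hν ha0)
    obtain ⟨d, hd⟩ := WithTop.ne_top_iff_exists.1 (v_ne_top hν ht0)
    have hni : n = i := by
      have h1 : i ≤ n := by
        have : (i : WithTop ℤ) ≤ ν a := ha
        rw [← hn] at this; exact_mod_cast this
      have h2 : ¬ (i + 1 ≤ n) := by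
        intro h
        apply hz
        rw [hker _ _ ha]
        change ((i + 1 : ℤ) : WithTop ℤ) ≤ ν a
        rw [← hn]; exact_mod_cast h
      omega
    subst hni
    have hmt : φ n a * φ d t = φ (n + d) s := by
      rw [← hmul _ _ _ ha _ hd.le]
      rw [hst, div_mul_cancel₀ _ ht0]
    have hνs : ν s = ((n + d : ℤ) : WithTop ℤ) := by
      have : s = a * t := by rw [hst, div_mul_cancel₀ _ ht0]
      rw [this, v_mul hν, ← hn, ← hd]; rfl
    have htne : φ d t ≠ 0 := by
      intro h
      rw [hker _ _ hd.le] at h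
      have h' : ((d + 1 : ℤ) : WithTop ℤ) ≤ ν t := h
      rw [← hd] at h'
      have h4 : d + 1 ≤ d := by exact_mod_cast h'
      omega
    have hιt : ι (φ d t) ≠ 0 := fun h => htne (hι (by rw [h, map_zero]))
    have : ι (φ n a) = ι (φ (n + d) s) / ι (φ d t) := by
      rw [eq_div_iff hιt, ← map_mul, hmt]
    rw [this]
    exact hdivmem _ _ (hmon s hs _ hνs) (hmon t ht _ hd.symm)
  have hG : ∀ g : G, ι g ∈ e.range := by
    have h1 : (⨆ i, 𝒢 i) ≤ (Subalgebra.toSubmodule e.range).comap ι.toLinearMap :=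
      iSup_le fun i g hg => hG1 i g hg
    rw [hint.submodule_iSup_eq_top] at h1
    intro g
    exact h1 (Submodule.mem_top (x := g))
  have hbij : Function.Bijective e := by
    refine ⟨e.toRingHom.injective, fun q => ?_⟩
    obtain ⟨a, b, hb, h⟩ := hLfrac q
    have hιb : ι b ≠ 0 := fun h => hb (hι (by rw [h, map_zero]))
    have : q = ι a / ι b := by rw [eq_div_iff hιb, h]
    rw [this]
    exact hdivmem _ _ (hG a) (hG b)
  have hP : ∀ a b, e (PB.bracket a b) = PL.bracket (e a) (e b) := by
    refine poisson_hom PB PL e _ hfrac ?_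
    rintro _ ⟨w, rfl⟩ _ ⟨u, rfl⟩
    simp only
    rw [hlam, map_smul, map_mul, he, he, hYd, hYd, ← hιbr, hY0d, hY0d,
      hbr _ _ _ (hXF w) _ (hXF u), hlam, hsmul, hmul _ _ _ (hXF w) _ (hXF u), map_smul, map_mul]
    change ((deg w + deg u : ℤ) : WithTop ℤ) ≤ _
    rw [v_mul hν, hdeg, hdeg]; rfl
  let E := AlgEquiv.ofBijective e hbij
  refine ⟨E.symm, fun a b => ?_⟩
  apply E.injective
  rw [E.apply_symm_apply]
  change _ = e _
  rw [hP]
  change _ = PL.bracket (E _) (E _)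
  rw [E.apply_symm_apply, E.apply_symm_apply]

end gr

section torus
variable {k K : Type*} [Field k] [Field K] [Algebra k K] {m : ℕ}

/-- The monomial homomorphism `u ↦ x^u`. -/
def mon (x : Fin m → Kˣ) : Multiplicative (Fin m → ℤ) →* Kˣ where
  toFun u := ∏ i, x i ^ (Multiplicative.toAdd u i)
  map_one' := by simp
  map_mul' u w := by simp [zpow_add, Finset.prod_mul_distrib]

/-- The logarithmic derivative attached to a bracket. -/
def dlog (PB : PoissonBracket k K) (a : K) : Kˣ →* Multiplicative K where
  toFun y := Multiplicative.ofAdd (PB.bracket a y / y)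
  map_one' := by simp [one_right]
  map_mul' y z := by
    rw [← ofAdd_add]
    congr 1
    have hy := y.ne_zero
    have hz := z.ne_zero
    rw [Units.val_mul, PB.leibniz]
    field_simp

lemma dlog_mon (PB : PoissonBracket k K) (a : K) (x : Fin m → Kˣ) (u : Fin m → ℤ) :
    PB.bracket a ((∏ i, x i ^ u i : Kˣ) : K) / ((∏ i, x i ^ u i : Kˣ) : K) =
      ∑ i, (u i : K) * (PB.bracket a (x i) / x i) := by
  have h : Multiplicative.toAdd (dlog PB a (∏ i, x i ^ u i)) =
      ∑ i, u i • Multiplicative.toAdd (dlog PB a (x i)) := by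
    rw [map_prod, toAdd_prod]
    refine Finset.sum_congr rfl fun i _ => ?_
    rw [map_zpow, toAdd_zpow]
  refine Eq.trans h ?_
  refine Finset.sum_congr rfl fun i _ => ?_
  rw [zsmul_eq_mul]; rfl

/-- The exponent form of the bracket. -/
def lamF (pij : Fin m → Fin m → k) (w u : Fin m → ℤ) : k :=
  ∑ j, (u j : k) * ∑ i, (w i : k) * pij i j

lemma lamF_sub (pij : Fin m → Fin m → k) (w u u' : Fin m → ℤ) :
    lamF pij w (u - u') = lamF pij w u - lamF pij w u' := by
  simp [lamF, sub_mul, Finset.sum_sub_distrib]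

lemma bracket_mon (PB : PoissonBracket k K) (x : Fin m → Kˣ) (pij : Fin m → Fin m → k)
    (hbr : ∀ i j : Fin m, PB.bracket (x i) (x j) =
      algebraMap k K (pij i j) * ((x i : K) * (x j : K))) (w u : Fin m → ℤ) :
    PB.bracket ((∏ i, x i ^ w i : Kˣ) : K) ((∏ i, x i ^ u i : Kˣ) : K) =
      lamF pij w u • (((∏ i, x i ^ w i : Kˣ) : K) * ((∏ i, x i ^ u i : Kˣ) : K)) := by
  set W := (∏ i, x i ^ w i : Kˣ) with hW
  set U := (∏ i, x i ^ u i : Kˣ) with hU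
  have h1 : ∀ j, PB.bracket (W : K) (x j) / x j =
      (∑ i, (w i : K) * algebraMap k K (pij i j)) * W := by
    intro j
    have h2 := dlog_mon PB (x j) x w
    rw [← hW, div_eq_iff W.ne_zero] at h2
    rw [PB.antisymm, h2, div_eq_iff (x j).ne_zero, Finset.sum_mul, Finset.sum_mul,
      Finset.sum_mul, ← Finset.sum_neg_distrib]
    refine Finset.sum_congr rfl fun i _ => ?_
    rw [PB.antisymm, hbr]
    have hx := (x i).ne_zero
    field_simp
  have h3 := dlog_mon PB W x u
  rw [← hU, div_eq_iff U.ne_zero] at h3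
  rw [h3, Algebra.smul_def, lamF, map_sum, ← mul_assoc]
  congr 1
  rw [Finset.sum_mul]
  refine Finset.sum_congr rfl fun j _ => ?_
  rw [h1, map_mul, map_sum, map_intCast, mul_assoc]
  congr 2
  exact Finset.sum_congr rfl fun i _ => by rw [map_mul, map_intCast]

lemma nondeg (PB : PoissonBracket k K) (X : Multiplicative (Fin m → ℤ) →* K)
    (T : Subalgebra k K)
    (hX : LinearIndependent k (fun u : Fin m → ℤ => X (Multiplicative.ofAdd u)))
    (hspan : ∀ t : K, t ∈ T ↔
      t ∈ Submodule.span k (Set.range (fun u : Fin m → ℤ => X (Multiplicative.ofAdd u))))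
    (lam : (Fin m → ℤ) → (Fin m → ℤ) → k)
    (hlam : ∀ w u : Fin m → ℤ,
      PB.bracket (X (Multiplicative.ofAdd w)) (X (Multiplicative.ofAdd u)) =
      lam w u • (X (Multiplicative.ofAdd w) * X (Multiplicative.ofAdd u)))
    (hTbr : ∀ a ∈ T, ∀ b ∈ T, PB.bracket a b ∈ T)
    (hsimple : ∀ I : Ideal T,
      (∀ a : T, a ∈ I → ∀ b c : T, (c : K) = PB.bracket b a → c ∈ I) →
      I = ⊥ ∨ I = ⊤) (v : Fin m → ℤ) (hv : v ≠ 0) : ∃ w, lam w v ≠ 0 := by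
  by_contra! hcon
  have hXT : X (Multiplicative.ofAdd v) ∈ T := (hspan _).2 (Submodule.subset_span ⟨v, rfl⟩)
  have hcen : ∀ b ∈ T, PB.bracket b (X (Multiplicative.ofAdd v)) = 0 := by
    intro b hb
    rw [hspan] at hb
    rw [PB.antisymm, neg_eq_zero]
    have : Submodule.span k (Set.range (fun u : Fin m → ℤ => X (Multiplicative.ofAdd u))) ≤
        LinearMap.ker (adL PB (X (Multiplicative.ofAdd v))) := by
      rw [Submodule.span_le]
      rintro _ ⟨w, rfl⟩
      simp only [SetLike.mem_coe, LinearMap.mem_ker, adL_apply]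
      rw [PB.antisymm, hlam, hcon, zero_smul, neg_zero]
    exact this hb
  let y : T := ⟨X (Multiplicative.ofAdd v), hXT⟩ - 1
  have hy : (y : K) = X (Multiplicative.ofAdd v) - 1 := rfl
  have hyb : ∀ b ∈ T, PB.bracket b y = 0 := by
    intro b hb
    rw [hy, ← adL_apply, map_sub, adL_apply, adL_apply, hcen b hb, one_right, sub_zero]
  have hI : ∀ a : T, a ∈ Ideal.span {y} → ∀ b c : T, (c : K) = PB.bracket b a →
      c ∈ Ideal.span {y} := by
    intro a ha b c hc
    rw [Ideal.mem_span_singleton'] at ha ⊢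
    obtain ⟨s, rfl⟩ := ha
    refine ⟨⟨PB.bracket b s, hTbr _ b.2 _ s.2⟩, Subtype.ext ?_⟩
    rw [hc, Subalgebra.coe_mul, Subalgebra.coe_mul, PB.leibniz, hyb b b.2, zero_mul, add_zero]
  rcases hsimple (Ideal.span {y}) hI with h | h
  · rw [Ideal.span_singleton_eq_bot] at h
    have h1 : X (Multiplicative.ofAdd v) = X (Multiplicative.ofAdd 0) := by
      rw [ofAdd_zero, map_one, ← sub_eq_zero, ← hy, h]; rfl
    exact hv (hX.injective h1)
  · rw [Ideal.eq_top_iff_one, Ideal.mem_span_singleton'] at h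
    obtain ⟨s, hs⟩ := h
    refine aug_ne X hX v (s : K) ((hspan _).1 s.2) ?_
    rw [← hy, ← Subalgebra.coe_mul, hs]; rfl

lemma val_mon {ν : K → WithTop ℤ} (hν : IsValuationOn k K ν) (x : Fin m → Kˣ) (v : Fin m → ℤ)
    (h : ∀ i, ν (x i) = (v i : WithTop ℤ)) (u : Fin m → ℤ) :
    ν ((∏ i, x i ^ u i : Kˣ) : K) = ((∑ i, u i * v i : ℤ) : WithTop ℤ) := by
  have hne : ∀ y : Kˣ, ν y ≠ ⊤ := fun y => v_ne_top hν y.ne_zero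
  let N : Kˣ →* Multiplicative ℤ :=
    { toFun := fun y => Multiplicative.ofAdd ((ν y).untop (hne y))
      map_one' := by
        have : (ν ((1 : Kˣ) : K)).untop (hne 1) = 0 := by
          apply WithTop.coe_injective
          rw [WithTop.coe_untop, Units.val_one, v_one hν]; rfl
        rw [this]; rfl
      map_mul' := fun y z => by
        rw [← ofAdd_add]
        congr 1
        apply WithTop.coe_injective
        rw [WithTop.coe_add, WithTop.coe_untop, WithTop.coe_untop, WithTop.coe_untop,
          Units.val_mul, v_mul hν] }
  have hN : ∀ y : Kˣ, ν y = ((Multiplicative.toAdd (N y) : ℤ) : WithTop ℤ) := fun y =>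
    (WithTop.coe_untop _ (hne y)).symm
  rw [hN, map_prod, toAdd_prod]
  congr 1
  refine Finset.sum_congr rfl fun i _ => ?_
  rw [map_zpow, toAdd_zpow, smul_eq_mul]
  congr 1
  have := hN (x i)
  rw [h] at this
  exact_mod_cast this.symm

end torus

end Stmt16Aux

/-- let `T = k[x₁^{±1},…,x_m^{±1}]` be a Poisson torus with
bracket `{x_i,x_j} = p_{ij} x_i x_j`, suppose `T` is Poisson simple, and let
`K = Q(T)` be its Poisson fraction field.  (We realize `T` as a subalgebra of
`K` whose Laurent monomials in the units `x i` form a `k`-basis.)  Then: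
(1) 0-valuations on `K` are in bijection with `ℤ^m` via `ν ↦ (ν x₁, …, ν x_m)`;
(2) for every 0-valuation `ν` on `K`, the Poisson fraction field of the
associated graded algebra `gr_ν(K)` is isomorphic to `K` as a Poisson field.
The associated graded algebra is formalized by quantifying over all
realizations `(G, 𝒢, φ)` of `gr` of the filtration `F i = {a : ν a ≥ i}`. -/
theorem stmt16 (k K : Type*) [Field k] [CharZero k] [Field K] [Algebra k K]
    (PB : PoissonBracket k K) (m : ℕ) (x : Fin m → Kˣ) (pij : Fin m → Fin m → k)
    (T : Subalgebra k K)
    -- the Laurent monomials in the `x i` form a `k`-basis of `T`: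
    (hLI : LinearIndependent k (fun v : Fin m → ℤ => ((∏ i, x i ^ v i : Kˣ) : K)))
    (hspan : ∀ t : K, t ∈ T ↔
      t ∈ Submodule.span k (Set.range (fun v : Fin m → ℤ => ((∏ i, x i ^ v i : Kˣ) : K))))
    -- the Poisson bracket of the torus:
    (hbr : ∀ i j : Fin m, PB.bracket (x i) (x j) =
      algebraMap k K (pij i j) * ((x i : K) * (x j : K)))
    (hTbr : ∀ a ∈ T, ∀ b ∈ T, PB.bracket a b ∈ T)
    -- `T` is Poisson simple:
    (hsimple : ∀ I : Ideal T,
      (∀ a : T, a ∈ I → ∀ b c : T, (c : K) = PB.bracket b a → c ∈ I) →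
      I = ⊥ ∨ I = ⊤)
    -- `K` is the Poisson fraction field of `T`:
    (hfrac : ∀ q : K, ∃ a ∈ T, ∃ b ∈ T, b ≠ 0 ∧ q = a / b) :
    -- (1) 0-valuations correspond bijectively to `ℤ^m`:
    (∀ v : Fin m → ℤ, ∃! ν : K → WithTop ℤ,
      IsValuationOn k K ν ∧
      (∀ a b : K, ν a + ν b ≤ ν (PB.bracket a b)) ∧
      (∀ i : Fin m, ν (x i) = (v i : WithTop ℤ))) ∧
    -- (2) for every 0-valuation `ν`, `Q(gr_ν K) ≅ K` as Poisson fields: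
    (∀ ν : K → WithTop ℤ, IsValuationOn k K ν →
      (∀ a b : K, ν a + ν b ≤ ν (PB.bracket a b)) →
      ∀ (G : Type) [CommRing G] [Algebra k G], ∀ (PG : PoissonBracket k G)
        (𝒢 : ℤ → Submodule k G) (φ : ℤ → K → G),
        -- `(G, 𝒢, φ)` realizes the associated graded algebra `gr_ν(K)`
        (∀ i : ℤ, ∀ a ∈ valFilt ν i, φ i a ∈ 𝒢 i) →
        (∀ i : ℤ, ∀ a ∈ valFilt ν i, ∀ b ∈ valFilt ν i,
          φ i (a + b) = φ i a + φ i b) →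
        (∀ (i : ℤ) (c : k), ∀ a ∈ valFilt ν i, φ i (c • a) = c • φ i a) →
        (∀ i : ℤ, ∀ a ∈ valFilt ν i, (φ i a = 0 ↔ a ∈ valFilt ν (i + 1))) →
        (∀ i : ℤ, ∀ g ∈ 𝒢 i, ∃ a ∈ valFilt ν i, φ i a = g) →
        φ 0 1 = 1 →
        (∀ i j : ℤ, ∀ a ∈ valFilt ν i, ∀ b ∈ valFilt ν j,
          φ (i + j) (a * b) = φ i a * φ j b) →
        DirectSum.IsInternal 𝒢 →
        (∀ i j : ℤ, ∀ a ∈ valFilt ν i, ∀ b ∈ valFilt ν j,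
          PG.bracket (φ i a) (φ j b) = φ (i + j) (PB.bracket a b)) →
        -- for every Poisson fraction field `L` of `G`:
        ∀ (L : Type) [Field L] [Algebra k L], ∀ (PL : PoissonBracket k L)
          (ι : G →ₐ[k] L),
          Function.Injective ι →
          (∀ q : L, ∃ a b : G, b ≠ 0 ∧ q * ι b = ι a) →
          (∀ a b : G, ι (PG.bracket a b) = PL.bracket (ι a) (ι b)) →
          -- `L ≅ K` as Poisson fields:
          ∃ e : L ≃ₐ[k] K, ∀ a b : L,
            e (PL.bracket a b) = PB.bracket (e a) (e b)) := by
  classical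
  let X : Multiplicative (Fin m → ℤ) →* K := (Units.coeHom K).comp (Stmt16Aux.mon x)
  have hXd : ∀ u : Fin m → ℤ, X (Multiplicative.ofAdd u) = ((∏ i, x i ^ u i : Kˣ) : K) :=
    fun u => rfl
  have hX : LinearIndependent k (fun u : Fin m → ℤ => X (Multiplicative.ofAdd u)) := hLI
  have hspan' : ∀ t : K, t ∈ T ↔
      t ∈ Submodule.span k (Set.range (fun u : Fin m → ℤ => X (Multiplicative.ofAdd u))) := hspan
  have hlam : ∀ w u : Fin m → ℤ,
      PB.bracket (X (Multiplicative.ofAdd w)) (X (Multiplicative.ofAdd u)) =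
      Stmt16Aux.lamF pij w u • (X (Multiplicative.ofAdd w) * X (Multiplicative.ofAdd u)) :=
    Stmt16Aux.bracket_mon PB x pij hbr
  have hnd : ∀ u u', u ≠ u' → ∃ w, Stmt16Aux.lamF pij w u ≠ Stmt16Aux.lamF pij w u' := by
    intro u u' h
    obtain ⟨w, hw⟩ := Stmt16Aux.nondeg PB X T hX hspan' _ hlam hTbr hsimple (u - u')
      (sub_ne_zero.2 h)
    rw [Stmt16Aux.lamF_sub] at hw
    exact ⟨w, sub_ne_zero.1 hw⟩
  have hfrac' : ∀ q : K,
      ∃ a ∈ Submodule.span k (Set.range (fun u : Fin m → ℤ => X (Multiplicative.ofAdd u))),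
      ∃ b ∈ Submodule.span k (Set.range (fun u : Fin m → ℤ => X (Multiplicative.ofAdd u))),
        b ≠ 0 ∧ q = a / b := by
    intro q
    obtain ⟨a, ha, b, hb, h⟩ := hfrac q
    exact ⟨a, (hspan' a).1 ha, b, (hspan' b).1 hb, h⟩
  refine ⟨fun v => ?_, ?_⟩
  · let deg : (Fin m → ℤ) →+ ℤ :=
      { toFun := fun u => ∑ i, u i * v i
        map_zero' := by simp
        map_add' := fun a b => by simp [add_mul, Finset.sum_add_distrib] }
    obtain ⟨ν, hν, h0, hd⟩ := Stmt16Aux.val_exists PB X hX hfrac' _ hlam deg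
    have hνx : ∀ i, ν (x i) = (v i : WithTop ℤ) := by
      intro i
      have h1 := hd (Pi.single i 1)
      have h2 : X (Multiplicative.ofAdd (Pi.single i 1)) = x i := by
        rw [hXd, Finset.prod_eq_single i]
        · simp
        · intro j _ hj; simp [Pi.single_eq_of_ne hj]
        · simp
      have h3 : deg (Pi.single i 1) = v i := by
        change ∑ j, (Pi.single i 1 : Fin m → ℤ) j * v j = v i
        rw [Finset.sum_eq_single i]
        · simp
        · intro j _ hj; simp [Pi.single_eq_of_ne hj]
        · simp
      rwa [h2, h3] at h1
    refine ⟨ν, ⟨hν, h0, hνx⟩, ?_⟩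
    rintro μ ⟨hμ, h0', hμx⟩
    refine Stmt16Aux.val_unique PB _ (fun u => hX.ne_zero u) hfrac' _ hlam hnd μ ν hμ hν h0' h0 ?_
    intro u
    rw [hXd, Stmt16Aux.val_mon hμ x v hμx, Stmt16Aux.val_mon hν x v hνx]
  · intro ν hν h0 G _ _ PG 𝒢 φ h1 h2 h3 h4 h5 h6 h7 h8 h9 L _ _ PL ι hι hL hιb
    exact Stmt16Aux.gr_iso PB X hX hfrac' _ hlam hnd ν hν h0 PG 𝒢 φ h1 h2 h3 h4 h5 h6 h7 h8 h9
      PL ι hι hL hιb
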